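/- Let T^n = {z ∈ ℂ^n : |z_1| = ⋯ = |z_n| = 1} be the n-torus with normalized Haar (Lebesgue) probability measure m, and let 1 ≤ p < ∞. If Y is a closed linear subspace of L^p(m) that is translation-invariant (for every f ∈ Y and w ∈ T^n the function z ↦ f(w·z), with coordinatewise multiplication w·z, belongs to Y), then Y equals the L^p-closure of the linear span of the set of monomials {z ↦ z^k : k ∈ ℤ^n} whose L^p-classes belong to Y, where z^k = z_1^{k_1}·…·z_n^{k_n}. -/

import Mathlib

open MeasureTheory
open scoped ENNReal

/-- For `k ∈ ℤ^n`, the trigonometric monomial `z ↦ z^k = z₁^{k₁} ⋯ z_n^{k_n}` on the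
`n`-torus, as a continuous complex-valued function. -/
noncomputable def torusMonomial (n : ℕ) (k : Fin n → ℤ) : C(Fin n → Circle, ℂ) where
  toFun z := ∏ j, (z j : ℂ) ^ k j
  continuous_toFun := by
    refine continuous_finset_prod _ fun j _ => ?_
    have h : (fun z : Fin n → Circle => (z j : ℂ) ^ k j)
        = fun z : Fin n → Circle => ((z j ^ k j : Circle) : ℂ) := by
      funext z
      exact (map_zpow' Circle.coeHom Circle.coe_inv (z j) (k j)).symm
    rw [h]
    have h2 : Continuous fun z : Fin n → Circle => z j ^ k j :=
      (continuous_zpow (k j)).comp (continuous_apply j)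
    exact h2.subtype_val

section General

variable {G : Type*} [CommGroup G] [TopologicalSpace G] [IsTopologicalGroup G] [CompactSpace G]
  [T2Space G] [SecondCountableTopology G] [MeasurableSpace G] [BorelSpace G]

/-- Continuous functions on a compact group are integrable. -/
theorem torusAux_integrable {E : Type*} [NormedAddCommGroup E]
    (m : Measure G) [IsFiniteMeasure m] {f : G → E} (hf : Continuous f) : Integrable f m :=
  hf.integrable_of_hasCompactSupport (HasCompactSupport.of_compactSpace f)

/-- Two conjugate-multiplied characters are orthogonal or equal. -/
theorem torusAux_orth (m : Measure G) [m.IsHaarMeasure] (χ ψ : C(G, ℂ))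
    (hχ : ∀ v w, χ (v * w) = χ v * χ w) (hψ : ∀ v w, ψ (v * w) = ψ v * ψ w)
    (h1 : ∀ v, χ v * star (χ v) = 1)
    (h : ∫ w, star (χ w) * ψ w ∂m ≠ 0) : χ = ψ := by
  ext v
  have key : ∫ w, star (χ w) * ψ w ∂m = (star (χ v) * ψ v) * ∫ w, star (χ w) * ψ w ∂m := by
    rw [← integral_const_mul]
    rw [← integral_mul_left_eq_self _ v]
    congr 1
    ext w
    rw [hχ, hψ, star_mul]
    ring
  have h2 : star (χ v) * ψ v = 1 := by
    have := mul_right_cancel₀ h ((one_mul _).trans key)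
    exact this.symm
  calc χ v = χ v * (star (χ v) * ψ v) := by rw [h2, mul_one]
    _ = ψ v := by rw [← mul_assoc, h1, one_mul]

theorem torusAux_general {κ : Type*} (χ : κ → C(G, ℂ))
    (hχ : ∀ k v w, χ k (v * w) = χ k v * χ k w)
    (h1 : ∀ k v, χ k v * star (χ k v) = 1)
    (hstar : ∀ k, ∃ l, ∀ v, χ l v = star (χ k v))
    (hdense : (Submodule.span ℂ (Set.range χ)).topologicalClosure = ⊤)
    (m : Measure G) [m.IsHaarMeasure] [IsProbabilityMeasure m]
    (p : ℝ≥0∞) [Fact (1 ≤ p)] (hp : p ≠ ∞)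
    (Y : Submodule ℂ (Lp ℂ p m)) (hYclosed : IsClosed (Y : Set (Lp ℂ p m)))
    (hYinv : ∀ f ∈ Y, ∀ w : G, ∀ g : Lp ℂ p m,
      (⇑g =ᵐ[m] fun z => f (w * z)) → g ∈ Y) :
    Y = (Submodule.span ℂ {g : Lp ℂ p m |
      (∃ k, g = ContinuousMap.toLp p m ℂ (χ k)) ∧ g ∈ Y}).topologicalClosure := by
  have : Fact (p ≠ ∞) := ⟨hp⟩
  have hcont : ∀ f : Lp ℂ p m, Continuous fun w : G => DomMulAct.mk w • f := fun f => by
    have : Continuous (DomMulAct.mk : G → Gᵈᵐᵃ) := DomMulAct.continuous_mk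
    fun_prop
  have hcont2 : ∀ (k : κ) (f : Lp ℂ p m),
      Continuous fun w : G => star (χ k w) • (DomMulAct.mk w • f) := fun k f =>
    ((χ k).continuous.star).smul (hcont f)
  have hint := fun k f => torusAux_integrable m (hcont2 k f)
  have hn1 : ∀ k v, ‖χ k v‖ = 1 := fun k v => by
    have := congrArg norm (h1 k v)
    rw [norm_mul, norm_star, norm_one] at this
    nlinarith [norm_nonneg (χ k v)]
  -- the Fourier projections
  let A : κ → (Lp ℂ p m →ₗ[ℂ] Lp ℂ p m) := fun k =>
    { toFun := fun f => ∫ w, star (χ k w) • (DomMulAct.mk w • f) ∂m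
      map_add' := fun f g => by
        rw [← integral_add (hint k f) (hint k g)]
        congr 1; ext1 w
        rw [smul_add, smul_add]
      map_smul' := fun c f => by
        simp only [RingHom.id_apply]
        rw [← integral_smul]
        congr 1; ext1 w
        rw [smul_comm (DomMulAct.mk w) c f, smul_comm c (star (χ k w))] }
  have hAcont : ∀ k, Continuous (A k) := fun k => by
    refine (LinearMap.mkContinuous (A k) 1 fun f => ?_).continuous
    refine (norm_integral_le_of_norm_le_const (C := ‖f‖) (.of_forall fun w => ?_)).trans ?_
    · rw [norm_smul, norm_star, hn1, one_mul, DomMulAct.norm_smul_Lp]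
    · simp
  have hAχ : ∀ k j, A k (ContinuousMap.toLp p m ℂ (χ j)) =
      (∫ w, star (χ k w) * χ j w ∂m) • ContinuousMap.toLp p m ℂ (χ j) := fun k j => by
    rw [← integral_smul_const]
    change ∫ w, _ ∂m = _
    congr 1; ext1 w
    rw [mul_smul]
    congr 1
    apply Lp.ext
    refine (DomMulAct.smul_Lp_ae_eq _ _).trans ?_
    have e1 := ContinuousMap.coeFn_toLp (p := p) (𝕜 := ℂ) m (χ j)
    have e2 := (measurePreserving_mul_left m w).quasiMeasurePreserving.ae_eq_comp e1
    filter_upwards [e1, e2, Lp.coeFn_smul (χ j w) (ContinuousMap.toLp p m ℂ (χ j))] with z h1 h2 h3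
    rw [h3, Pi.smul_apply, h1]
    simpa [hχ] using h2
  have hdenseLp : Dense (Submodule.span ℂ (Set.range fun j =>
      ContinuousMap.toLp p m ℂ (χ j)) : Set (Lp ℂ p m)) := by
    have hd : Dense (Submodule.span ℂ (Set.range χ) : Set C(G, ℂ)) := by
      rw [Submodule.dense_iff_topologicalClosure_eq_top]; exact hdense
    have := (ContinuousMap.toLp_denseRange (p := p) (E := ℂ) m ℂ hp).dense_image
      (ContinuousMap.toLp p m ℂ).continuous hd
    convert this
    have := Submodule.map_span (ContinuousMap.toLp p m ℂ : C(G, ℂ) →L[ℂ] Lp ℂ p m).toLinearMap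
      (Set.range χ)
    rw [← Set.range_comp] at this
    exact (congrArg (fun S : Submodule ℂ (Lp ℂ p m) => (S : Set (Lp ℂ p m))) this).symm
  have hAmem : ∀ k f, A k f ∈ Submodule.span ℂ {ContinuousMap.toLp p m ℂ (χ k)} := fun k f => by
    have hcl : IsClosed {f | A k f ∈ Submodule.span ℂ {ContinuousMap.toLp p m ℂ (χ k)}} :=
      (Submodule.closed_of_finiteDimensional
        (Submodule.span ℂ {ContinuousMap.toLp p m ℂ (χ k)})).preimage (hAcont k)
    refine hcl.closure_subset_iff.2 ?_ (hdenseLp f)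
    change Submodule.span ℂ _ ≤
      (Submodule.span ℂ {ContinuousMap.toLp p m ℂ (χ k)}).comap (A k)
    rw [Submodule.span_le]
    rintro _ ⟨j, rfl⟩
    change A k _ ∈ Submodule.span ℂ _
    rw [hAχ]
    by_cases h : ∫ w, star (χ k w) * χ j w ∂m = 0
    · rw [h, zero_smul]; exact zero_mem _
    · rw [torusAux_orth m (χ k) (χ j) (hχ k) (hχ j) (h1 k) h]
      exact Submodule.smul_mem _ _ (Submodule.mem_span_singleton_self _)
  have hAY : ∀ k, ∀ f ∈ Y, A k f ∈ Y := fun k f hf => by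
    refine Convex.integral_mem (s := (Y : Set (Lp ℂ p m))) ?_ hYclosed
      (.of_forall fun w => ?_) (hint k f)
    · exact (Y.restrictScalars ℝ).convex
    · refine Y.smul_mem _ (hYinv f hf w _ ?_)
      exact DomMulAct.smul_Lp_ae_eq _ _
  set B := {g : Lp ℂ p m | (∃ k, g = ContinuousMap.toLp p m ℂ (χ k)) ∧ g ∈ Y} with hB
  have hAB : ∀ k, ∀ f ∈ Y, A k f ∈ Submodule.span ℂ B := fun k f hf => by
    obtain ⟨c, hc⟩ := Submodule.mem_span_singleton.1 (hAmem k f)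
    have hY := hAY k f hf
    rw [← hc] at hY ⊢
    by_cases h0 : c = 0
    · rw [h0, zero_smul]; exact zero_mem _
    · refine Submodule.smul_mem _ _ (Submodule.subset_span ⟨⟨k, rfl⟩, ?_⟩)
      exact (Submodule.smul_mem_iff _ h0).1 hY
  apply le_antisymm
  · intro f hf
    set S := (Submodule.span ℂ B).topologicalClosure with hS
    have hSc : IsClosed (S : Set (Lp ℂ p m)) := Submodule.isClosed_topologicalClosure _
    by_contra hfS
    have hne : S.mkQ f ≠ 0 := by
      rwa [Ne, Submodule.mkQ_apply, Submodule.Quotient.mk_eq_zero]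
    obtain ⟨ℓ0, hℓ0⟩ := SeparatingDual.exists_ne_zero (R := ℂ) hne
    let ℓ : Lp ℂ p m →L[ℂ] ℂ := ℓ0.comp S.mkQL
    have hℓS : ∀ g ∈ S, ℓ g = 0 := fun g hg => by
      change ℓ0 (S.mkQ g) = 0
      rw [(by rwa [Submodule.mkQ_apply, Submodule.Quotient.mk_eq_zero] : S.mkQ g = 0), map_zero]
    have hℓf : ℓ f ≠ 0 := hℓ0
    let h : C(G, ℂ) := ⟨fun w => ℓ (DomMulAct.mk w • f), ℓ.continuous.comp (hcont f)⟩
    have hχh : ∀ k, ∫ w, χ k w * h w ∂m = 0 := fun k => by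
      obtain ⟨l, hl⟩ := hstar k
      have e := hℓS _ (Submodule.le_topologicalClosure _ (hAB l f hf))
      change ℓ (∫ w, _ ∂m) = 0 at e
      rw [← ℓ.integral_comp_comm (hint l f)] at e
      rw [← e]
      congr 1; ext1 w
      rw [map_smul, hl, star_star]
      rfl
    have hcont3 : ∀ φ : C(G, ℂ), Integrable (fun w => φ w * h w) m := fun φ =>
      torusAux_integrable m (φ.continuous.mul h.continuous)
    let I : C(G, ℂ) →ₗ[ℂ] ℂ :=
      { toFun := fun φ => ∫ w, φ w * h w ∂m
        map_add' := fun φ ψ => by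
          rw [← integral_add (hcont3 φ) (hcont3 ψ)]
          congr 1; ext1 w
          simp [add_mul]
        map_smul' := fun c φ => by
          rw [RingHom.id_apply, ← integral_smul]
          congr 1; ext1 w
          simp [mul_assoc] }
    have hIcont : Continuous I := by
      refine (LinearMap.mkContinuous I ‖h‖ fun φ => ?_).continuous
      refine (norm_integral_le_of_norm_le_const (C := ‖h‖ * ‖φ‖) (.of_forall fun w => ?_)).trans ?_
      · rw [norm_mul, mul_comm]
        gcongr
        · exact h.norm_coe_le_norm w
        · exact φ.norm_coe_le_norm w
      · simp
    have hI0 : ∀ φ, I φ = 0 := fun φ => by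
      have hcl : IsClosed ((LinearMap.ker I : Submodule ℂ C(G, ℂ)) : Set C(G, ℂ)) :=
        isClosed_singleton.preimage hIcont
      have : (Submodule.span ℂ (Set.range χ)).topologicalClosure ≤ LinearMap.ker I := by
        refine Submodule.topologicalClosure_minimal _ ?_ hcl
        rw [Submodule.span_le]
        rintro _ ⟨k, rfl⟩
        exact hχh k
      rw [hdense] at this
      exact this (Submodule.mem_top)
    have h2 : ∫ w, ‖h w‖ ^ 2 ∂m = 0 := by
      have e : ∫ w, star (h w) * h w ∂m = 0 := hI0 (star h)
      have e' : ∀ w, star (h w) * h w = ((‖h w‖ ^ 2 : ℝ) : ℂ) := fun w => by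
        push_cast
        exact RCLike.conj_mul (h w)
      simp_rw [e'] at e
      rw [integral_complex_ofReal] at e
      exact_mod_cast e
    have hc2 : Continuous fun w => ‖h w‖ ^ 2 := by fun_prop
    have h3 := (integral_eq_zero_iff_of_nonneg (fun w => sq_nonneg _)
      (torusAux_integrable m hc2)).1 h2
    have h4 := (Continuous.ae_eq_iff_eq m hc2 continuous_zero).1 h3
    have h5 := congrFun h4 1
    apply hℓf
    have h6 : h 1 = 0 := by simpa using h5
    have h7 : h 1 = ℓ f := by
      change ℓ (DomMulAct.mk 1 • f) = ℓ f
      rw [DomMulAct.mk_one, one_smul]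
    rw [← h7, h6]
  · refine Submodule.topologicalClosure_minimal _ ?_ hYclosed
    rw [Submodule.span_le]
    exact fun g hg => hg.2

end General

theorem torusAux_dense (n : ℕ) :
    (Submodule.span ℂ (Set.range (torusMonomial n))).topologicalClosure = ⊤ := by
  have hadd : ∀ k l, torusMonomial n (k + l) = torusMonomial n k * torusMonomial n l := by
    intro k l
    ext z
    simp only [torusMonomial, ContinuousMap.coe_mk, ContinuousMap.mul_apply, Pi.add_apply]
    rw [← Finset.prod_mul_distrib]
    exact Finset.prod_congr rfl fun j _ => zpow_add₀ (Circle.coe_ne_zero _) _ _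
  let S : StarSubalgebra ℂ C(Fin n → Circle, ℂ) :=
    { toSubalgebra := Algebra.adjoin ℂ (Set.range (torusMonomial n))
      star_mem' := by
        change Algebra.adjoin ℂ (Set.range (torusMonomial n)) ≤
          star (Algebra.adjoin ℂ (Set.range (torusMonomial n)))
        refine Algebra.adjoin_le ?_
        rintro _ ⟨k, rfl⟩
        refine Algebra.subset_adjoin ⟨-k, ?_⟩
        ext z
        simp [torusMonomial, ← Circle.coe_inv_eq_conj] }
  have hS : S.toSubalgebra.toSubmodule = Submodule.span ℂ (Set.range (torusMonomial n)) := by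
    apply Algebra.adjoin_eq_span_of_subset
    refine .trans (fun x ↦ Submonoid.closure_induction (fun _ ↦ id) ⟨0, ?_⟩ ?_)
      Submodule.subset_span
    · ext z
      simp [torusMonomial]
    · rintro _ _ _ _ ⟨k, rfl⟩ ⟨l, rfl⟩
      exact ⟨k + l, hadd k l⟩
  have hsep : S.SeparatesPoints := by
    classical
    intro x y hxy
    rw [Ne, funext_iff, not_forall] at hxy
    obtain ⟨i, hi⟩ := hxy
    refine ⟨_, ⟨torusMonomial n (Pi.single i 1), Algebra.subset_adjoin ⟨Pi.single i 1, rfl⟩, rfl⟩, ?_⟩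
    have hs : ∀ z : Fin n → Circle, torusMonomial n (Pi.single i 1) z = z i := fun z => by
      simp only [torusMonomial, ContinuousMap.coe_mk]
      rw [Finset.prod_eq_single i]
      · simp
      · intro j _ hj
        simp [Pi.single_eq_of_ne hj]
      · simp
    dsimp only
    rw [hs, hs]
    exact fun h => hi (Subtype.coe_injective h)
  rw [← hS]
  exact congr_arg (Subalgebra.toSubmodule <| StarSubalgebra.toSubalgebra ·)
    (ContinuousMap.starSubalgebra_topologicalClosure_eq_top_of_separatesPoints S hsep)

/-- Let `m` be the Haar probability measure on the `n`-torus and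
`1 ≤ p < ∞`. If `Y` is a closed translation-invariant linear subspace of `L^p(m)`, then `Y`
is the `L^p`-closure of the linear span of the set of (classes of) monomials `z ↦ z^k`
(`k ∈ ℤⁿ`) whose `L^p`-classes belong to `Y`. -/
theorem closed_translation_invariant_subspace_Lp_torus
    (n : ℕ) {mΩ : MeasurableSpace (Fin n → Circle)} [BorelSpace (Fin n → Circle)]
    (m : Measure (Fin n → Circle)) [m.IsHaarMeasure] [IsProbabilityMeasure m]
    (p : ℝ≥0∞) [Fact (1 ≤ p)] (hp : p ≠ ∞)
    (Y : Submodule ℂ (Lp ℂ p m)) (hYclosed : IsClosed (Y : Set (Lp ℂ p m)))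
    (hYinv : ∀ f ∈ Y, ∀ w : Fin n → Circle, ∀ g : Lp ℂ p m,
      (⇑g =ᵐ[m] fun z => f (w * z)) → g ∈ Y) :
    Y = (Submodule.span ℂ {g : Lp ℂ p m |
      (∃ k : Fin n → ℤ, g = ContinuousMap.toLp p m ℂ (torusMonomial n k)) ∧
      g ∈ Y}).topologicalClosure := by
  have hstar : ∀ k (v : Fin n → Circle), torusMonomial n (-k) v = star (torusMonomial n k v) := by
    intro k v
    simp [torusMonomial, ← Circle.coe_inv_eq_conj]
  refine torusAux_general (torusMonomial n) (fun k v w => ?_) (fun k v => ?_)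
    (fun k => ⟨-k, hstar k⟩) (torusAux_dense n) m p hp Y hYclosed hYinv
  · simp [torusMonomial, mul_zpow, Finset.prod_mul_distrib]
  · rw [← hstar]
    simp only [torusMonomial, ContinuousMap.coe_mk]
    rw [← Finset.prod_mul_distrib]
    refine Finset.prod_eq_one fun j _ => ?_
    rw [Pi.neg_apply, zpow_neg]
    exact mul_inv_cancel₀ (zpow_ne_zero _ (Circle.coe_ne_zero _))
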